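/- Let φ be a non-negative non-increasing function on (0,∞) with ∫₀^∞ φ(u) u^{-1/2} du < ∞. Then lim_{t→∞} ∫₀^t φ(u) (t−u)^{-1/2} du = 0. -/

import Mathlib

open MeasureTheory Filter Set

/-- A nonnegative antitone function on `(0,∞)` with `φ(u) u^{-1/2}` integrable vanishes at `∞`. -/
theorem tendsto_zero_of_antitoneOn_of_integrableOn_div_sqrt
    {φ : ℝ → ℝ} (hnonneg : ∀ u, 0 < u → 0 ≤ φ u) (hanti : AntitoneOn φ (Ioi 0))
    (hint : IntegrableOn (fun u => φ u / Real.sqrt u) (Ioi 0)) :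
    Tendsto φ atTop (nhds 0) := by
  have key : ∀ ε > 0, ∃ a, 0 < a ∧ φ a < ε := by
    intro ε hε
    by_contra! h
    have hsqrt : IntegrableOn (fun u : ℝ => u ^ (-(1 / 2) : ℝ)) (Ioi 1) := by
      refine Integrable.mono' ((hint.mono_set (Ioi_subset_Ioi zero_le_one)).const_mul ε⁻¹)
        (by fun_prop) ?_
      filter_upwards [ae_restrict_mem measurableSet_Ioi] with u hu
      have hu0 : (0 : ℝ) < u := zero_lt_one.trans hu
      rw [Real.norm_of_nonneg (by positivity), Real.rpow_neg hu0.le, ← Real.sqrt_eq_rpow,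
        ← mul_div_assoc, ← one_div]
      gcongr
      rw [inv_mul_eq_div, one_le_div hε]
      exact h u hu0
    rw [integrableOn_Ioi_rpow_iff one_pos] at hsqrt
    norm_num at hsqrt
  rw [Metric.tendsto_atTop]
  intro ε hε
  obtain ⟨a, ha, hφ⟩ := key ε hε
  refine ⟨a, fun u hu => ?_⟩
  have hu0 : 0 < u := ha.trans_le hu
  rw [Real.dist_0_eq_abs, abs_of_nonneg (hnonneg u hu0)]
  exact (hanti ha hu0 hu).trans_lt hφ

/-- Dominated convergence to zero on the expanding intervals `(0, t / 2]`. -/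
theorem tendsto_intervalIntegral_half_of_dominated
    {ψ : ℝ → ℝ → ℝ} {g : ℝ → ℝ} (hg : IntegrableOn g (Ioi 0)) (hg0 : ∀ u, 0 < u → 0 ≤ g u)
    (hmeas : ∀ t, AEStronglyMeasurable (ψ t) (volume.restrict (Ioc 0 (t / 2))))
    (hle : ∀ t, ∀ u ∈ Ioc 0 (t / 2), ‖ψ t u‖ ≤ g u)
    (hlim : ∀ u, 0 < u → Tendsto (fun t => ψ t u) atTop (nhds 0)) :
    (∀ t, 0 ≤ t → IntervalIntegrable (ψ t) volume 0 (t / 2)) ∧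
      Tendsto (fun t => ∫ u in (0 : ℝ)..(t / 2), ψ t u) atTop (nhds 0) := by
  constructor
  · intro t ht
    rw [intervalIntegrable_iff_integrableOn_Ioc_of_le (by positivity)]
    refine Integrable.mono' (hg.mono_set Ioc_subset_Ioi_self) (hmeas t) ?_
    filter_upwards [ae_restrict_mem measurableSet_Ioc] with u hu using hle t u hu
  · have h := tendsto_integral_filter_of_dominated_convergence (l := atTop)
      (μ := volume.restrict (Ioi 0)) (F := fun t => (Ioc 0 (t / 2)).indicator (ψ t))
      (f := fun _ => 0) g
      (Eventually.of_forall fun t => by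
        rw [aestronglyMeasurable_indicator_iff measurableSet_Ioc,
          Measure.restrict_restrict_of_subset Ioc_subset_Ioi_self]
        exact hmeas t)
      (Eventually.of_forall fun t => by
        filter_upwards [ae_restrict_mem measurableSet_Ioi] with u hu
        by_cases h : u ∈ Ioc 0 (t / 2)
        · simpa [indicator_of_mem h] using hle t u h
        · simpa [indicator_of_notMem h] using hg0 u hu)
      hg
      (by
        filter_upwards [ae_restrict_mem measurableSet_Ioi] with u hu
        refine (hlim u hu).congr' ?_
        filter_upwards [eventually_ge_atTop (2 * u)] with t ht
        rw [indicator_of_mem]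
        exact ⟨hu, by linarith⟩)
    rw [integral_zero] at h
    refine h.congr' ?_
    filter_upwards [eventually_ge_atTop 0] with t ht
    rw [intervalIntegral.integral_of_le (by positivity), integral_indicator measurableSet_Ioc,
      Measure.restrict_restrict_of_subset Ioc_subset_Ioi_self]

/-- if `φ ≥ 0` is non-increasing on `(0,∞)` with `∫₀^∞ φ(u) u^{-1/2} du < ∞`,
then `∫₀^t φ(u) (t-u)^{-1/2} du → 0` as `t → ∞`. -/
theorem tendsto_integral_inv_sqrt_sub_atTop_nhds_zero
    (φ : ℝ → ℝ) (hnonneg : ∀ u, 0 < u → 0 ≤ φ u) (hanti : AntitoneOn φ (Ioi 0))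
    (hint : IntegrableOn (fun u => φ u / Real.sqrt u) (Ioi 0)) :
    Tendsto (fun t => ∫ u in Ioo 0 t, φ u / Real.sqrt (t - u)) atTop (nhds 0) := by
  have hφ := tendsto_zero_of_antitoneOn_of_integrableOn_div_sqrt hnonneg hanti hint
  have hg0 : ∀ u, 0 < u → 0 ≤ φ u / Real.sqrt u := fun u hu =>
    div_nonneg (hnonneg u hu) (Real.sqrt_nonneg u)
  obtain ⟨hleft_int, hleft⟩ := tendsto_intervalIntegral_half_of_dominated
    (ψ := fun t u => φ u / Real.sqrt (t - u)) hint hg0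
    (fun t => by
      have hm : AEMeasurable φ (volume.restrict (Ioc 0 (t / 2))) :=
        aemeasurable_restrict_of_antitoneOn measurableSet_Ioc (hanti.mono Ioc_subset_Ioi_self)
      exact (hm.div (by fun_prop)).aestronglyMeasurable)
    (fun t u hu => by
      have hφu := hnonneg u hu.1
      rw [Real.norm_of_nonneg (by positivity)]
      have := Real.sqrt_pos.2 hu.1
      gcongr
      linarith [hu.2])
    (fun u _ => by
      refine Tendsto.div_atTop tendsto_const_nhds (Real.tendsto_sqrt_atTop.comp ?_)
      exact tendsto_atTop_add_const_right atTop (-u) tendsto_id)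
  obtain ⟨hright_int, hright⟩ := tendsto_intervalIntegral_half_of_dominated
    (ψ := fun t u => φ (t - u) / Real.sqrt u) hint hg0
    (fun t => by
      have hm : AEMeasurable (fun u => φ (t - u)) (volume.restrict (Ioc 0 (t / 2))) := by
        refine aemeasurable_restrict_of_monotoneOn measurableSet_Ioc fun x hx y hy hxy => ?_
        refine hanti (mem_Ioi.2 ?_) (mem_Ioi.2 ?_) (by linarith) <;>
          linarith [hx.1, hx.2, hy.1, hy.2]
      exact (hm.div (by fun_prop)).aestronglyMeasurable)
    (fun t u hu => by
      have hut : 0 < t - u := by linarith [hu.1, hu.2]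
      have hφu := hnonneg _ hut
      rw [Real.norm_of_nonneg (by positivity)]
      gcongr
      exact hanti hu.1 hut (by linarith [hu.2]))
    (fun u _ => by
      have h : Tendsto (fun t => φ (t - u)) atTop (nhds 0) :=
        hφ.comp (tendsto_atTop_add_const_right atTop (-u) tendsto_id)
      simpa using h.div_const (Real.sqrt u))
  have hsum := hleft.add hright
  rw [add_zero] at hsum
  refine hsum.congr' ?_
  filter_upwards [eventually_ge_atTop 0] with t ht
  have hsub : t - t / 2 = t / 2 := by ring
  have hint' : IntervalIntegrable (fun u => φ u / Real.sqrt (t - u)) volume (t / 2) t := by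
    have h := ((hright_int t ht).comp_sub_left t).symm
    simpa [hsub] using h
  have hcov : ∫ u in (0 : ℝ)..(t / 2), φ (t - u) / Real.sqrt u =
      ∫ u in (t / 2)..t, φ u / Real.sqrt (t - u) := by
    have h := intervalIntegral.integral_comp_sub_left (a := 0) (b := t / 2)
      (fun u => φ u / Real.sqrt (t - u)) t
    simpa [hsub] using h
  rw [hcov, intervalIntegral.integral_add_adjacent_intervals (hleft_int t ht) hint',
    intervalIntegral.integral_of_le ht, integral_Ioc_eq_integral_Ioo]
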